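/- arXiv:1310.6391 — 2 statements merged into one kernel-verified Lean document; each statement's English description precedes it below -/
import Mathlib

section
/- Let S be a measurable space, let ν be a probability measure on S, let β, γ ∈ ℝ\{0} with β < γ, and let g : S → ℝ be bounded and measurable. Then (1/γ) log ∫_S e^{γg} dν = sup over all probability measures θ on S of [ (1/β) log ∫_S e^{βg} dθ − (1/(γ−β)) R_{γ/(γ−β)}(θ‖ν) ]. -/
open MeasureTheory Real ProbabilityTheory
open scoped Classical

/-- Rényi divergence of order `α > 0`, `α ≠ 1`, of `ν` from `θ`, defined using densities with
respect to the dominating measure `ν + θ`. -/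
noncomputable def renyiDivAux {S : Type*} [MeasurableSpace S] (α : ℝ)
    (ν θ : Measure S) : EReal :=
  if 1 < α ∧ ¬ ν ≪ θ then ⊤
  else ((α * (α - 1))⁻¹ : ℝ) *
    ENNReal.log (∫⁻ x in {x | 0 < ν.rnDeriv (ν + θ) x ∧ 0 < θ.rnDeriv (ν + θ) x},
      (ν.rnDeriv (ν + θ) x / θ.rnDeriv (ν + θ) x) ^ α ∂θ)

/-- Rényi divergence of order `α ∈ ℝ \ {0, 1}`, extended to negative orders by
`R_α(ν‖θ) = R_{1-α}(θ‖ν)`. -/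
noncomputable def renyiDiv {S : Type*} [MeasurableSpace S] (α : ℝ)
    (ν θ : Measure S) : EReal :=
  if α < 0 then renyiDivAux (1 - α) θ ν else renyiDivAux α ν θ

open scoped ENNReal

section RenyiSup

variable {S : Type*} [MeasurableSpace S]

/-- The set where the densities of both measures with respect to their sum are positive. -/
def posSet (ν θ : Measure S) : Set S :=
  {x | 0 < ν.rnDeriv (ν + θ) x ∧ 0 < θ.rnDeriv (ν + θ) x}

/-- The ratio of the densities of two measures with respect to their sum. -/
noncomputable def densityRatio (ν θ : Measure S) (x : S) : ℝ≥0∞ :=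
  ν.rnDeriv (ν + θ) x / θ.rnDeriv (ν + θ) x

lemma measurable_densityRatio (ν θ : Measure S) : Measurable (densityRatio ν θ) :=
  (Measure.measurable_rnDeriv _ _).div (Measure.measurable_rnDeriv _ _)

lemma measurableSet_posSet (ν θ : Measure S) : MeasurableSet (posSet ν θ) :=
  (measurableSet_lt measurable_const (Measure.measurable_rnDeriv _ _)).inter
    (measurableSet_lt measurable_const (Measure.measurable_rnDeriv _ _))

lemma renyiDivAux_of_ac {α : ℝ} {ν θ : Measure S} (h : 1 < α → ν ≪ θ) :
    renyiDivAux α ν θ = ((α * (α - 1))⁻¹ : ℝ) *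
      ENNReal.log (∫⁻ x in posSet ν θ, densityRatio ν θ x ^ α ∂θ) :=
  if_neg fun hh => hh.2 (h hh.1)

lemma absolutelyContinuous_add_left (ν θ : Measure S) : ν ≪ ν + θ :=
  Measure.absolutelyContinuous_of_le (Measure.le_add_right le_rfl)

lemma absolutelyContinuous_add_right (ν θ : Measure S) : θ ≪ ν + θ :=
  Measure.absolutelyContinuous_of_le (Measure.le_add_left le_rfl)

/-- On the set of positive densities, the ratio of densities acts as a change of measure. -/
lemma setLIntegral_densityRatio_mul (ν θ : Measure S) [IsFiniteMeasure ν] [IsFiniteMeasure θ]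
    {f : S → ℝ≥0∞} (hf : Measurable f) :
    ∫⁻ x in posSet ν θ, densityRatio ν θ x * f x ∂θ = ∫⁻ x in posSet ν θ, f x ∂ν := by
  have hA := measurableSet_posSet ν θ
  have hr := measurable_densityRatio ν θ
  rw [← lintegral_indicator hA, ← lintegral_indicator hA,
    ← lintegral_rnDeriv_mul (absolutelyContinuous_add_right ν θ)
      (Measurable.indicator (f := fun x => densityRatio ν θ x * f x) (hr.mul hf) hA).aemeasurable,
    ← lintegral_rnDeriv_mul (absolutelyContinuous_add_left ν θ)
      (hf.indicator hA).aemeasurable]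
  refine lintegral_congr_ae ?_
  filter_upwards [θ.rnDeriv_ne_top (ν + θ)] with x hx
  by_cases hxA : x ∈ posSet ν θ
  · simp only [Set.indicator_of_mem hxA]
    rw [← mul_assoc, densityRatio, ENNReal.mul_div_cancel hxA.2.ne' hx]
  · simp [Set.indicator_of_notMem hxA]

lemma ae_mem_posSet {ν θ : Measure S} [IsFiniteMeasure ν] [IsFiniteMeasure θ] (h : ν ≪ θ) :
    ∀ᵐ x ∂ν, x ∈ posSet ν θ := by
  filter_upwards [Measure.rnDeriv_pos (absolutelyContinuous_add_left ν θ),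
    h.ae_le (Measure.rnDeriv_pos (absolutelyContinuous_add_right ν θ))] with x h₁ h₂
  exact ⟨h₁, h₂⟩

lemma ofReal_exp_rpow (a p : ℝ) :
    ENNReal.ofReal (exp a) ^ p = ENNReal.ofReal (exp (a * p)) := by
  rw [ENNReal.ofReal_rpow_of_pos (exp_pos _), Real.exp_mul]

lemma integrable_exp_mul_of_bounded {g : S → ℝ} (hg : Measurable g)
    (hgbd : ∃ C : ℝ, ∀ x, |g x| ≤ C) (μ : Measure S) [IsFiniteMeasure μ] (t : ℝ) :
    Integrable (fun x => exp (t * g x)) μ := by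
  obtain ⟨C, hC⟩ := hgbd
  refine Integrable.of_bound (by fun_prop) (exp (|t| * C)) (ae_of_all _ fun x => ?_)
  rw [Real.norm_eq_abs, abs_of_pos (exp_pos _), exp_le_exp]
  calc t * g x ≤ |t * g x| := le_abs_self _
    _ = |t| * |g x| := abs_mul _ _
    _ ≤ |t| * C := by gcongr; exact hC x

lemma lintegral_ofReal_exp_mul {g : S → ℝ} (hg : Measurable g)
    (hgbd : ∃ C : ℝ, ∀ x, |g x| ≤ C) (μ : Measure S) [IsFiniteMeasure μ] (t : ℝ) :
    ∫⁻ x, ENNReal.ofReal (exp (t * g x)) ∂μ = ENNReal.ofReal (∫ x, exp (t * g x) ∂μ) :=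
  (ofReal_integral_eq_lintegral_ofReal (integrable_exp_mul_of_bounded hg hgbd μ t)
    (ae_of_all _ fun _ => (exp_pos _).le)).symm

lemma integral_exp_mul_pos {g : S → ℝ} (hg : Measurable g)
    (hgbd : ∃ C : ℝ, ∀ x, |g x| ≤ C) (μ : Measure S) [IsProbabilityMeasure μ] (t : ℝ) :
    0 < ∫ x, exp (t * g x) ∂μ :=
  integral_exp_pos (integrable_exp_mul_of_bounded hg hgbd μ t)

/-- For `0 < b < c`, the Rényi divergence of order `c / (c - b) > 1` controls exponential
integrals. -/
lemma renyiDivAux_order_gt_one {g : S → ℝ} (hg : Measurable g)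
    (hgbd : ∃ C : ℝ, ∀ x, |g x| ≤ C) (θ ν : Measure S) [IsProbabilityMeasure θ]
    [IsProbabilityMeasure ν] {b c : ℝ} (hb : 0 < b) (hbc : b < c) :
    renyiDivAux (c / (c - b)) θ ν = ⊤ ∨ ∃ r : ℝ, renyiDivAux (c / (c - b)) θ ν = r ∧
      b⁻¹ * log (∫ x, exp (b * g x) ∂θ) - (c - b)⁻¹ * r ≤
        c⁻¹ * log (∫ x, exp (c * g x) ∂ν) := by
  have hc : 0 < c := hb.trans hbc
  have hd : 0 < c - b := sub_pos.2 hbc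
  set α := c / (c - b) with hα
  have hα1 : α - 1 = b / (c - b) := by rw [hα]; field_simp; ring
  have hα0 : 0 < α := by positivity
  have hk : (0 : ℝ) < (α * (α - 1))⁻¹ := by rw [hα1]; positivity
  by_cases hac : θ ≪ ν
  swap
  · exact Or.inl (if_pos ⟨sub_pos.1 (by rw [hα1]; positivity), hac⟩)
  rw [renyiDivAux_of_ac fun _ => hac]
  set I := ∫⁻ x in posSet θ ν, densityRatio θ ν x ^ α ∂ν
  set N := ∫ x, exp (b * g x) ∂θ
  set M := ∫ x, exp (c * g x) ∂ν
  have hN : 0 < N := integral_exp_mul_pos hg hgbd θ b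
  have hM : 0 < M := integral_exp_mul_pos hg hgbd ν c
  have holder : ENNReal.ofReal N ≤ I ^ α⁻¹ * ENNReal.ofReal M ^ (b / c) := by
    calc ENNReal.ofReal N = ∫⁻ x, ENNReal.ofReal (exp (b * g x)) ∂θ :=
          (lintegral_ofReal_exp_mul hg hgbd θ b).symm
      _ = ∫⁻ x in posSet θ ν, ENNReal.ofReal (exp (b * g x)) ∂θ := by
          rw [Measure.restrict_eq_self_of_ae_mem (ae_mem_posSet hac)]
      _ = ∫⁻ x in posSet θ ν, densityRatio θ ν x * ENNReal.ofReal (exp (b * g x)) ∂ν :=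
          (setLIntegral_densityRatio_mul θ ν (by fun_prop)).symm
      _ = ∫⁻ x in posSet θ ν, (densityRatio θ ν x ^ α) ^ α⁻¹ *
            ENNReal.ofReal (exp (c * g x)) ^ (b / c) ∂ν := by
          refine lintegral_congr fun x => ?_
          rw [ENNReal.rpow_rpow_inv hα0.ne', ofReal_exp_rpow]
          congr 3
          field_simp
      _ ≤ I ^ α⁻¹ * (∫⁻ x in posSet θ ν, ENNReal.ofReal (exp (c * g x)) ∂ν) ^ (b / c) :=
          ENNReal.lintegral_mul_norm_pow_le
            ((measurable_densityRatio θ ν).pow_const _).aemeasurable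
            (by fun_prop) (by positivity) (by positivity) (by rw [hα]; field_simp; ring)
      _ ≤ I ^ α⁻¹ * ENNReal.ofReal M ^ (b / c) := by
          rw [← lintegral_ofReal_exp_mul hg hgbd ν c]
          gcongr
          exact Measure.restrict_le_self
  have hI0 : I ≠ 0 := fun h => by
    rw [h, ENNReal.zero_rpow_of_pos (by positivity), zero_mul] at holder
    exact (ENNReal.ofReal_pos.2 hN).not_ge holder
  by_cases hIt : I = ⊤
  · left
    rw [hIt, ENNReal.log_top, EReal.coe_mul_top_of_pos hk]
  refine Or.inr ⟨(α * (α - 1))⁻¹ * log I.toReal, ?_, ?_⟩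
  · rw [ENNReal.log_pos_real hI0 hIt, EReal.coe_mul]
  have hlog := ENNReal.log_le_log holder
  rw [ENNReal.log_mul_add, ENNReal.log_rpow, ENNReal.log_rpow, ENNReal.log_ofReal_of_pos hN,
    ENNReal.log_ofReal_of_pos hM, ENNReal.log_pos_real hI0 hIt] at hlog
  norm_cast at hlog
  have hmul := mul_le_mul_of_nonneg_left hlog (inv_pos.2 hb).le
  have e : b⁻¹ * (α⁻¹ * log I.toReal + b / c * log M) =
      (c - b)⁻¹ * ((α * (α - 1))⁻¹ * log I.toReal) + c⁻¹ * log M := by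
    rw [hα1, hα]; field_simp
  linarith

/-- For `b < 0 < c`, the Rényi divergence of order `c / (c - b) ∈ (0, 1)` controls exponential
integrals. -/
lemma renyiDivAux_order_lt_one {g : S → ℝ} (hg : Measurable g)
    (hgbd : ∃ C : ℝ, ∀ x, |g x| ≤ C) (θ ν : Measure S) [IsProbabilityMeasure θ]
    [IsProbabilityMeasure ν] {b c : ℝ} (hb : b < 0) (hc : 0 < c) :
    renyiDivAux (c / (c - b)) θ ν = ⊤ ∨ ∃ r : ℝ, renyiDivAux (c / (c - b)) θ ν = r ∧
      b⁻¹ * log (∫ x, exp (b * g x) ∂θ) - (c - b)⁻¹ * r ≤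
        c⁻¹ * log (∫ x, exp (c * g x) ∂ν) := by
  have hd : 0 < c - b := by linarith
  set α := c / (c - b) with hα
  have hα1 : α - 1 = b / (c - b) := by rw [hα]; field_simp; ring
  have hα0 : 0 < α := by positivity
  have hα1' : α - 1 < 0 := by rw [hα1]; exact div_neg_of_neg_of_pos hb hd
  have hk : (α * (α - 1))⁻¹ < 0 := inv_lt_zero.2 (mul_neg_of_pos_of_neg hα0 hα1')
  rw [renyiDivAux_of_ac fun h => by linarith]
  set I := ∫⁻ x in posSet θ ν, densityRatio θ ν x ^ α ∂ν
  set N := ∫ x, exp (b * g x) ∂θ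
  set M := ∫ x, exp (c * g x) ∂ν
  have hN : 0 < N := integral_exp_mul_pos hg hgbd θ b
  have hM : 0 < M := integral_exp_mul_pos hg hgbd ν c
  have holder : I ≤ ENNReal.ofReal N ^ α * ENNReal.ofReal M ^ (1 - α) := by
    calc I = ∫⁻ x in posSet θ ν, (densityRatio θ ν x * ENNReal.ofReal (exp (b * g x))) ^ α *
            ENNReal.ofReal (exp (c * g x)) ^ (1 - α) ∂ν := by
          refine lintegral_congr fun x => ?_
          rw [ENNReal.mul_rpow_of_nonneg _ _ hα0.le, ofReal_exp_rpow, ofReal_exp_rpow,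
            mul_assoc, ← ENNReal.ofReal_mul (exp_pos _).le, ← Real.exp_add,
            show b * g x * α + c * g x * (1 - α) = 0 by rw [hα]; field_simp; ring]
          simp
      _ ≤ (∫⁻ x in posSet θ ν, densityRatio θ ν x * ENNReal.ofReal (exp (b * g x)) ∂ν) ^ α *
            (∫⁻ x in posSet θ ν, ENNReal.ofReal (exp (c * g x)) ∂ν) ^ (1 - α) :=
          ENNReal.lintegral_mul_norm_pow_le
            ((measurable_densityRatio θ ν).mul (by fun_prop)).aemeasurable
            (by fun_prop) hα0.le (by linarith) (by ring)
      _ ≤ ENNReal.ofReal N ^ α * ENNReal.ofReal M ^ (1 - α) := by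
          rw [setLIntegral_densityRatio_mul θ ν (by fun_prop),
            ← lintegral_ofReal_exp_mul hg hgbd ν c, ← lintegral_ofReal_exp_mul hg hgbd θ b]
          have : 0 ≤ 1 - α := by linarith
          gcongr <;> exact Measure.restrict_le_self
  have hIt : I ≠ ⊤ := ne_top_of_le_ne_top (ENNReal.mul_ne_top
    (ENNReal.rpow_ne_top_of_nonneg hα0.le ENNReal.ofReal_ne_top)
    (ENNReal.rpow_ne_top_of_nonneg (by linarith) ENNReal.ofReal_ne_top)) holder
  by_cases hI0 : I = 0
  · left
    rw [hI0, ENNReal.log_zero, EReal.coe_mul_bot_of_neg hk]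
  refine Or.inr ⟨(α * (α - 1))⁻¹ * log I.toReal, ?_, ?_⟩
  · rw [ENNReal.log_pos_real hI0 hIt, EReal.coe_mul]
  have hlog := ENNReal.log_le_log holder
  rw [ENNReal.log_mul_add, ENNReal.log_rpow, ENNReal.log_rpow, ENNReal.log_ofReal_of_pos hN,
    ENNReal.log_ofReal_of_pos hM, ENNReal.log_pos_real hI0 hIt] at hlog
  norm_cast at hlog
  have hpos : 0 ≤ -((c - b)⁻¹ * (α * (α - 1))⁻¹) := by
    have := mul_neg_of_pos_of_neg (inv_pos.2 hd) hk
    linarith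
  have hmul := mul_le_mul_of_nonneg_left hlog hpos
  have e : -((c - b)⁻¹ * (α * (α - 1))⁻¹) * (α * log N + (1 - α) * log M) =
      -(b⁻¹ * log N) + c⁻¹ * log M := by
    rw [show 1 - α = -(α - 1) by ring, hα1, hα]
    have := hb.ne
    field_simp
    ring
  linarith

/-- The Rényi divergence `R_{γ/(γ-β)}(θ‖ν)` controls exponential integrals. -/
lemma renyiDiv_bound {g : S → ℝ} (hg : Measurable g)
    (hgbd : ∃ C : ℝ, ∀ x, |g x| ≤ C) (θ ν : Measure S) [IsProbabilityMeasure θ]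
    [IsProbabilityMeasure ν] {β γ : ℝ} (hβ : β ≠ 0) (hγ : γ ≠ 0) (hβγ : β < γ) :
    renyiDiv (γ / (γ - β)) θ ν = ⊤ ∨ ∃ r : ℝ, renyiDiv (γ / (γ - β)) θ ν = r ∧
      β⁻¹ * log (∫ x, exp (β * g x) ∂θ) - (γ - β)⁻¹ * r ≤
        γ⁻¹ * log (∫ x, exp (γ * g x) ∂ν) := by
  have hd : 0 < γ - β := sub_pos.2 hβγ
  rcases hγ.lt_or_gt with hγ0 | hγ0
  · rw [renyiDiv, if_pos (div_neg_of_neg_of_pos hγ0 hd)]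
    have h := renyiDivAux_order_gt_one (g := fun x => - g x) hg.neg (by simpa using hgbd) ν θ
      (neg_pos.2 hγ0) (neg_lt_neg hβγ)
    have e : 1 - γ / (γ - β) = -β / (-β - -γ) := by
      rw [show -β - -γ = γ - β by ring]; field_simp; ring
    rw [e]
    refine h.imp id ?_
    rintro ⟨r, hr, hle⟩
    refine ⟨r, hr, ?_⟩
    simp only [neg_mul_neg, inv_neg, show -β - -γ = γ - β by ring] at hle
    linarith
  · rw [renyiDiv, if_neg (div_pos hγ0 hd).not_gt]
    rcases hβ.lt_or_gt with hβ0 | hβ0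
    · exact renyiDivAux_order_lt_one hg hgbd θ ν hβ0 hγ0
    · exact renyiDivAux_order_gt_one hg hgbd θ ν hβ0 hβγ

lemma densityRatio_withDensity (ν : Measure S) [IsFiniteMeasure ν] {h : S → ℝ≥0∞}
    (hh : Measurable h) [IsFiniteMeasure (ν.withDensity h)] :
    densityRatio (ν.withDensity h) ν =ᵐ[ν] h := by
  have hac := absolutelyContinuous_add_right (ν.withDensity h) ν
  filter_upwards [Measure.rnDeriv_mul_rnDeriv' (μ := ν.withDensity h) hac,
    ν.rnDeriv_withDensity hh, Measure.rnDeriv_pos hac,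
    hac.ae_le (ν.rnDeriv_ne_top (ν.withDensity h + ν))] with x h₁ h₂ h₃ h₄
  rw [densityRatio, ← h₁, Pi.mul_apply, h₂, ENNReal.mul_div_cancel_right h₃.ne' h₄]

lemma renyiDivAux_withDensity (ν : Measure S) [IsFiniteMeasure ν] {h : S → ℝ≥0∞}
    (hh : Measurable h) (h0 : ∀ x, h x ≠ 0) [IsFiniteMeasure (ν.withDensity h)] (α : ℝ) :
    renyiDivAux α (ν.withDensity h) ν =
      ((α * (α - 1))⁻¹ : ℝ) * ENNReal.log (∫⁻ x, h x ^ α ∂ν) := by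
  have hac := withDensity_absolutelyContinuous ν h
  have hac' : ν ≪ ν.withDensity h :=
    withDensity_absolutelyContinuous' hh.aemeasurable (ae_of_all _ h0)
  rw [renyiDivAux_of_ac fun _ => hac,
    Measure.restrict_eq_self_of_ae_mem (hac'.ae_le (ae_mem_posSet hac))]
  congr 2
  refine lintegral_congr_ae ?_
  filter_upwards [densityRatio_withDensity ν hh] with x hx
  rw [hx]

lemma renyiDiv_withDensity (ν : Measure S) [IsFiniteMeasure ν] {h : S → ℝ≥0∞}
    (hh : Measurable h) (h0 : ∀ x, h x ≠ 0) (ht : ∀ x, h x ≠ ⊤)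
    [IsFiniteMeasure (ν.withDensity h)] (α : ℝ) :
    renyiDiv α (ν.withDensity h) ν =
      ((α * (α - 1))⁻¹ : ℝ) * ENNReal.log (∫⁻ x, h x ^ α ∂ν) := by
  unfold renyiDiv
  split_ifs with hα
  · set θ := ν.withDensity h with hθ
    have hν : θ.withDensity h⁻¹ = ν :=
      withDensity_inv_same hh (ae_of_all _ h0) (ae_of_all _ ht)
    have : IsFiniteMeasure (θ.withDensity h⁻¹) := by rw [hν]; infer_instance
    have key := renyiDivAux_withDensity θ hh.inv (fun x => ENNReal.inv_ne_zero.2 (ht x)) (1 - α)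
    rw [hν] at key
    rw [key, show (1 - α) * (1 - α - 1) = α * (α - 1) by ring, hθ,
      lintegral_withDensity_eq_lintegral_mul _ hh (by fun_prop)]
    congr 3 with x
    simp only [Pi.mul_apply, Pi.inv_apply]
    rw [ENNReal.inv_rpow, ← ENNReal.rpow_neg]
    nth_rewrite 1 [← ENNReal.rpow_one (h x)]
    rw [← ENNReal.rpow_add _ _ (h0 x) (ht x)]
    congr 1
    ring
  · exact renyiDivAux_withDensity ν hh h0 α

/-- The exponentially tilted measure `dθ ∝ exp ((γ - β) g) dν` attains the supremum. -/
lemma exists_renyiDiv_eq (ν : Measure S) [IsProbabilityMeasure ν]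
    {g : S → ℝ} (hg : Measurable g) (hgbd : ∃ C : ℝ, ∀ x, |g x| ≤ C)
    {β γ : ℝ} (hβ : β ≠ 0) (hγ : γ ≠ 0) (hβγ : β < γ) :
    ∃ θ : Measure S, IsProbabilityMeasure θ ∧ ∃ r : ℝ, renyiDiv (γ / (γ - β)) θ ν = r ∧
      β⁻¹ * log (∫ x, exp (β * g x) ∂θ) - (γ - β)⁻¹ * r =
        γ⁻¹ * log (∫ x, exp (γ * g x) ∂ν) := by
  have hd : γ - β ≠ 0 := (sub_pos.2 hβγ).ne'
  set Z := ∫ x, exp ((γ - β) * g x) ∂ν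
  set M := ∫ x, exp (γ * g x) ∂ν
  have hZ : 0 < Z := integral_exp_mul_pos hg hgbd ν _
  have hM : 0 < M := integral_exp_mul_pos hg hgbd ν _
  set h : S → ℝ≥0∞ := fun x => ENNReal.ofReal (exp ((γ - β) * g x - log Z)) with hhdef
  have hh : Measurable h := by fun_prop
  have lint (t s : ℝ) : ∫⁻ x, ENNReal.ofReal (exp (t * g x + s)) ∂ν =
      ENNReal.ofReal (exp s * ∫ x, exp (t * g x) ∂ν) := by
    simp_rw [Real.exp_add, mul_comm _ (exp s), ENNReal.ofReal_mul (exp_pos s).le]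
    rw [lintegral_const_mul _ (by fun_prop), lintegral_ofReal_exp_mul hg hgbd]
  have hθ : IsProbabilityMeasure (ν.withDensity h) := ⟨by
    rw [withDensity_apply _ MeasurableSet.univ, Measure.restrict_univ]
    simp only [hhdef, sub_eq_add_neg _ (log Z)]
    rw [lint, Real.exp_neg, Real.exp_log hZ, inv_mul_cancel₀ hZ.ne', ENNReal.ofReal_one]⟩
  have hN : ∫ x, exp (β * g x) ∂(ν.withDensity h) = exp (-log Z) * M := by
    rw [← ENNReal.ofReal_eq_ofReal_iff (integral_exp_mul_pos hg hgbd _ _).le (by positivity),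
      ← lint, ← lintegral_ofReal_exp_mul hg hgbd,
      lintegral_withDensity_eq_lintegral_mul _ hh (by fun_prop)]
    refine lintegral_congr fun x => ?_
    rw [Pi.mul_apply, hhdef, ← ENNReal.ofReal_mul (exp_pos _).le, ← Real.exp_add]
    congr 2
    ring
  set α := γ / (γ - β) with hα
  have hI : ∫⁻ x, h x ^ α ∂ν = ENNReal.ofReal (exp (-(α * log Z)) * M) := by
    rw [← lint]
    refine lintegral_congr fun x => ?_
    rw [hhdef, ofReal_exp_rpow]
    congr 2
    rw [hα]
    field_simp
    ring
  refine ⟨ν.withDensity h, hθ, (α * (α - 1))⁻¹ * log (exp (-(α * log Z)) * M), ?_, ?_⟩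
  · rw [renyiDiv_withDensity ν hh (fun x => (ENNReal.ofReal_pos.2 (exp_pos _)).ne')
      (fun x => ENNReal.ofReal_ne_top), hI, ENNReal.log_ofReal_of_pos (by positivity),
      EReal.coe_mul]
  · have hα1 : α - 1 = β / (γ - β) := by rw [hα]; field_simp; ring
    rw [hN, Real.log_mul (exp_pos _).ne' hM.ne', Real.log_mul (exp_pos _).ne' hM.ne',
      Real.log_exp, Real.log_exp, hα1, hα]
    field_simp
    ring

end RenyiSup

/-- **Variational upper-bound (supremum) representation for exponential integrals via Rényi
divergence.** For a probability measure `ν`, `β, γ ∈ ℝ \ {0}` with `β < γ`, and bounded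
measurable `g`,
`(1/γ) log ∫ e^{γg} dν = sup_θ [ (1/β) log ∫ e^{βg} dθ - (1/(γ-β)) R_{γ/(γ-β)}(θ‖ν) ]`,
the supremum being over all probability measures `θ`. -/
theorem renyi_sup_representation {S : Type*} [MeasurableSpace S]
    (ν : Measure S) [IsProbabilityMeasure ν]
    (β γ : ℝ) (hβ : β ≠ 0) (hγ : γ ≠ 0) (hβγ : β < γ)
    (g : S → ℝ) (hg : Measurable g) (hgbd : ∃ C : ℝ, ∀ x, |g x| ≤ C) :
    ((γ⁻¹ * Real.log (∫ x, Real.exp (γ * g x) ∂ν) : ℝ) : EReal) =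
      ⨆ (θ : Measure S) (_ : IsProbabilityMeasure θ),
        ((β⁻¹ * Real.log (∫ x, Real.exp (β * g x) ∂θ) : ℝ) : EReal)
          - (((γ - β)⁻¹ : ℝ) : EReal) * renyiDiv (γ / (γ - β)) θ ν := by
  apply le_antisymm
  · obtain ⟨θ, hθ, r, hr, heq⟩ := exists_renyiDiv_eq ν hg hgbd hβ hγ hβγ
    refine le_iSup₂_of_le θ hθ ?_
    rw [hr, ← heq]
    norm_cast
  · refine iSup₂_le fun θ hθ => ?_
    rcases renyiDiv_bound hg hgbd θ ν hβ hγ hβγ with htop | ⟨r, hr, hle⟩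
    · rw [htop, EReal.coe_mul_top_of_pos (inv_pos.2 (sub_pos.2 hβγ)), EReal.sub_top]
      exact bot_le
    · rw [hr]
      exact_mod_cast hle
end

section
/- Let S be a measurable space, let θ and ν be probability measures on S, let α > 2, and let g : S → ℝ be any measurable function (not necessarily bounded). Then (1/(α−2)) log ∫_S e^{(α−2)g} dν − R_{α−1}(ν‖θ) ≤ (1/(α−1)) log ∫_S e^{(α−1)g} dθ, where on the left-hand side the expression ∞ − ∞ is interpreted as −∞ and the inequality is interpreted in [−∞, +∞]. -/
open MeasureTheory Real ProbabilityTheory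
open scoped Classical

/-- The integral in the definition of the Rényi divergence is the integral of a power of the
Radon-Nikodym derivative. -/
lemma setLIntegral_rnDeriv_div_rpow {S : Type*} [MeasurableSpace S] (ν θ : Measure S)
    [SigmaFinite ν] [SigmaFinite θ] {β : ℝ} (hβ : 0 < β) :
    ∫⁻ x in {x | 0 < ν.rnDeriv (ν + θ) x ∧ 0 < θ.rnDeriv (ν + θ) x},
      (ν.rnDeriv (ν + θ) x / θ.rnDeriv (ν + θ) x) ^ β ∂θ
      = ∫⁻ x, ν.rnDeriv θ x ^ β ∂θ := by
  have hE : MeasurableSet {x | 0 < ν.rnDeriv (ν + θ) x ∧ 0 < θ.rnDeriv (ν + θ) x} :=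
    (measurableSet_lt measurable_const (Measure.measurable_rnDeriv _ _)).inter
      (measurableSet_lt measurable_const (Measure.measurable_rnDeriv _ _))
  rw [← lintegral_indicator hE]
  refine lintegral_congr_ae ?_
  filter_upwards [ν.rnDeriv_eq_div_rnDeriv_add θ,
    Measure.rnDeriv_pos (rfl.absolutelyContinuous.add_right' ν : θ ≪ ν + θ)] with x hx hpos
  rw [hx]
  by_cases h : 0 < ν.rnDeriv (ν + θ) x
  · rw [Set.indicator_of_mem]
    exact ⟨h, hpos⟩
  · rw [Set.indicator_of_notMem fun hmem => h hmem.1, not_lt, nonpos_iff_eq_zero] at *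
    simp [h, hβ]

/-- Hölder's inequality for a change of measure with exponential integrands. -/
lemma lintegral_exp_le_rpow_mul_rpow {S : Type*} [MeasurableSpace S] {ν θ : Measure S}
    [SigmaFinite ν] [SigmaFinite θ] (hac : ν ≪ θ) {β : ℝ} (hβ : 1 < β) {g : S → ℝ}
    (hg : Measurable g) :
    ∫⁻ x, ENNReal.ofReal (Real.exp ((β - 1) * g x)) ∂ν
      ≤ (∫⁻ x, ν.rnDeriv θ x ^ β ∂θ) ^ (1 / β)
        * (∫⁻ x, ENNReal.ofReal (Real.exp (β * g x)) ∂θ) ^ ((β - 1) / β) := by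
  have hm : Measurable fun x => ENNReal.ofReal (Real.exp ((β - 1) * g x)) := by fun_prop
  have h := ENNReal.lintegral_mul_le_Lp_mul_Lq θ (Real.HolderConjugate.conjExponent hβ)
    (Measure.measurable_rnDeriv ν θ).aemeasurable hm.aemeasurable
  have hβ' : β - 1 ≠ 0 := by linarith
  simp only [Pi.mul_apply, Real.conjExponent, one_div_div] at h
  rw [lintegral_rnDeriv_mul hac hm.aemeasurable] at h
  convert h using 5 with x
  rw [ENNReal.ofReal_rpow_of_pos (Real.exp_pos _), ← Real.exp_mul]
  congr 2
  field_simp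

/-- **Lower bound on risk-sensitive functionals (Corollary, left inequality).**
For probability measures `θ, ν`, `α > 2`, and any measurable `g` (not necessarily bounded),
`(1/(α-2)) log ∫ e^{(α-2)g} dν - R_{α-1}(ν‖θ) ≤ (1/(α-1)) log ∫ e^{(α-1)g} dθ`,
with integrals taken in `[0,∞]`, `∞ - ∞` interpreted as `-∞` (as in `EReal` subtraction),
and the inequality interpreted in `[-∞,∞]`. -/
theorem renyi_lower_bound {S : Type*} [MeasurableSpace S]
    (θ ν : Measure S) [IsProbabilityMeasure θ] [IsProbabilityMeasure ν]
    (α : ℝ) (hα : 2 < α) (g : S → ℝ) (hg : Measurable g) :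
    (((α - 2)⁻¹ : ℝ) : EReal)
        * ENNReal.log (∫⁻ x, ENNReal.ofReal (Real.exp ((α - 2) * g x)) ∂ν)
      - renyiDiv (α - 1) ν θ
      ≤ (((α - 1)⁻¹ : ℝ) : EReal)
          * ENNReal.log (∫⁻ x, ENNReal.ofReal (Real.exp ((α - 1) * g x)) ∂θ) := by
  obtain ⟨β, rfl⟩ : ∃ β, α = β + 1 := ⟨α - 1, by ring⟩
  have hβ : 1 < β := by linarith
  have hβ1 : 0 < β - 1 := by linarith
  rw [show β + 1 - 2 = β - 1 by ring, show β + 1 - 1 = β by ring]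
  rw [renyiDiv, if_neg (by linarith), renyiDivAux]
  by_cases hac : ν ≪ θ
  · rw [if_neg (by simp [hac]), setLIntegral_rnDeriv_div_rpow ν θ (by linarith)]
    refine EReal.sub_le_of_le_add ?_
    have h := ENNReal.log_monotone (lintegral_exp_le_rpow_mul_rpow hac hβ hg)
    rw [ENNReal.log_mul_add, ENNReal.log_rpow, ENNReal.log_rpow] at h
    have hc : (0 : EReal) ≤ (((β - 1)⁻¹ : ℝ) : EReal) := by
      exact_mod_cast (inv_pos.mpr hβ1).le
    refine (mul_le_mul_of_nonneg_left h hc).trans_eq ?_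
    rw [EReal.left_distrib_of_nonneg_of_ne_top hc (EReal.coe_ne_top _), ← mul_assoc, ← mul_assoc,
      ← EReal.coe_mul, ← EReal.coe_mul, add_comm]
    congr 4 <;> field_simp
  · simp [hac, hβ]
end
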